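/- arXiv:1701.08004 — 2 statements merged into one kernel-verified Lean document; each statement's English description precedes it below -/
import Mathlib

section
/- Suppose there is a constant λ ∈ ℝ with λ ≠ 0 and λ² ≠ 1 such that f31 = λ·f11, with f11 nowhere zero and f11′ nowhere zero. Assume the structure equations (S1)–(S3) hold and ∂F/∂z_k is nowhere zero. Then there exist no smooth functions a, b, c on any nonempty open set U ⊆ ℝ² satisfying the Codazzi identities (C1), (C2) and the Gauss equation a·c − b² = −1. -/
open Real Finset

/-- Partial derivative of `f` at `z` in the `i`-th coordinate direction. -/
noncomputable def pd {n : ℕ} (f : (Fin n → ℝ) → ℝ) (z : Fin n → ℝ) (i : ℕ) : ℝ :=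
  fderiv ℝ f z (fun j => if (j : ℕ) = i then 1 else 0)

/-- The `i`-th coordinate of `z` (junk value `0` out of range). -/
def zc {n : ℕ} (z : Fin n → ℝ) (i : ℕ) : ℝ :=
  if h : i < n then z ⟨i, h⟩ else 0

/-- `f` depends only on the first `m` coordinates `z_0, …, z_{m-1}`. -/
def DependsOnFirst {n : ℕ} (m : ℕ) (f : (Fin n → ℝ) → ℝ) : Prop :=
  ∀ z w : Fin n → ℝ, (∀ j : Fin n, (j : ℕ) < m → z j = w j) → f z = f w

/-- The structure equations (S1)–(S3), required at every point `(z_0, …, z_k) ∈ ℝ^{k+1}`. -/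
def StructEqs (k : ℕ) (η : ℝ) (f11 f31 : ℝ → ℝ)
    (f12 f22 f32 F : (Fin (k+1) → ℝ) → ℝ) : Prop :=
  ∀ z : Fin (k+1) → ℝ,
    deriv f11 (z 0) * F z =
      (∑ i ∈ Finset.range k, pd f12 z i * zc z (i+1)) + η * f32 z - f31 (z 0) * f22 z ∧
    (∑ i ∈ Finset.range (k-1), pd f22 z i * zc z (i+1)) =
      f11 (z 0) * f32 z - f31 (z 0) * f12 z ∧
    deriv f31 (z 0) * F z =
      (∑ i ∈ Finset.range k, pd f32 z i * zc z (i+1)) + η * f12 z - f11 (z 0) * f22 z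

/-- The Codazzi identities (C1) and (C2), required for every `(x,t) ∈ U` and every
`(z_0, …, z_{k-1})` (equivalently, every `z ∈ ℝ^{k+1}` since the data does not
depend on `z_k`).  Here `(1,0)` is the `∂/∂x` direction and `(0,1)` the `∂/∂t` one. -/
def Codazzi (k : ℕ) (η : ℝ) (f11 f31 : ℝ → ℝ) (f12 f22 f32 : (Fin (k+1) → ℝ) → ℝ)
    (U : Set (ℝ × ℝ)) (a b c : ℝ × ℝ → ℝ) : Prop :=
  ∀ p ∈ U, ∀ z : Fin (k+1) → ℝ,
    f11 (z 0) * fderiv ℝ a p (0, 1) + η * fderiv ℝ b p (0, 1)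
      - f12 z * fderiv ℝ a p (1, 0) - f22 z * fderiv ℝ b p (1, 0)
      - 2 * b p * (f11 (z 0) * f32 z - f31 (z 0) * f12 z)
      + (a p - c p) * (η * f32 z - f31 (z 0) * f22 z) = 0 ∧
    f11 (z 0) * fderiv ℝ b p (0, 1) + η * fderiv ℝ c p (0, 1)
      - f12 z * fderiv ℝ b p (1, 0) - f22 z * fderiv ℝ c p (1, 0)
      + (a p - c p) * (f11 (z 0) * f32 z - f31 (z 0) * f12 z)
      + 2 * b p * (η * f32 z - f31 (z 0) * f22 z) = 0

/-- The `i`-th coordinate vector of `Fin n → ℝ` (zero if `i` is out of range). -/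
def coordVec (n i : ℕ) : Fin n → ℝ := fun j => if (j : ℕ) = i then 1 else 0

/-- `f` does not depend on the `i`-th coordinate. -/
def IndepOfCoord {n : ℕ} (f : (Fin n → ℝ) → ℝ) (i : ℕ) : Prop :=
  ∀ (z : Fin n → ℝ) (s : ℝ), f (z + s • coordVec n i) = f z

lemma DependsOnFirst.indepOfCoord {n m : ℕ} {f : (Fin n → ℝ) → ℝ} (hf : DependsOnFirst m f)
    {i : ℕ} (hi : m ≤ i) : IndepOfCoord f i := by
  intro z s
  refine hf _ _ fun j hj => ?_
  have : (j : ℕ) ≠ i := by omega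
  simp [coordVec, this]

lemma hasDerivAt_comp_line {n : ℕ} {f : (Fin n → ℝ) → ℝ} (hf : Differentiable ℝ f)
    (z : Fin n → ℝ) (i : ℕ) (s : ℝ) :
    HasDerivAt (fun s : ℝ => f (z + s • coordVec n i)) (pd f (z + s • coordVec n i) i) s := by
  have hline : HasDerivAt (fun s : ℝ => z + s • coordVec n i) (coordVec n i) s := by
    simpa using ((hasDerivAt_id s).smul_const (coordVec n i)).const_add z
  exact (hf (z + s • coordVec n i)).hasFDerivAt.comp_hasDerivAt s hline

lemma pd_eq_zero_of_constant_line {n : ℕ} {f : (Fin n → ℝ) → ℝ} (hf : Differentiable ℝ f)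
    {z : Fin n → ℝ} {i : ℕ} (h : ∀ s : ℝ, f (z + s • coordVec n i) = f z) :
    pd f z i = 0 := by
  have hd := hasDerivAt_comp_line hf z i 0
  simp only [h, zero_smul, add_zero] at hd
  exact hd.unique (hasDerivAt_const _ _)

lemma exists_ne_of_pd_ne_zero {n : ℕ} {f : (Fin n → ℝ) → ℝ} (hf : Differentiable ℝ f)
    {z : Fin n → ℝ} {i : ℕ} (h : pd f z i ≠ 0) :
    ∃ s : ℝ, f (z + s • coordVec n i) ≠ f z := by
  by_contra! hc
  exact h (pd_eq_zero_of_constant_line hf hc)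

lemma indepOfCoord_of_pd_eq_zero {n : ℕ} {f : (Fin n → ℝ) → ℝ} (hf : Differentiable ℝ f)
    {i : ℕ} (h : ∀ z, pd f z i = 0) : IndepOfCoord f i := by
  intro z s
  have hc := is_const_of_deriv_eq_zero
    (fun s => (hasDerivAt_comp_line hf z i s).differentiableAt)
    (fun s => (hasDerivAt_comp_line hf z i s).deriv.trans (h _)) s 0
  simpa using hc

lemma IndepOfCoord.pd {n : ℕ} {f : (Fin n → ℝ) → ℝ} {i : ℕ} (hf : IndepOfCoord f i) (j : ℕ) :
    IndepOfCoord (fun z => pd f z j) i := by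
  intro z s
  have h := fderiv_comp_add_right (𝕜 := ℝ) (f := f) (x := z) (s • coordVec n i)
  simp only [hf _ s] at h
  simp only [_root_.pd, ← h]

lemma pd_sub_const_mul {n : ℕ} {f g : (Fin n → ℝ) → ℝ} (hf : Differentiable ℝ f)
    (hg : Differentiable ℝ g) (r : ℝ) (z : Fin n → ℝ) (i : ℕ) :
    pd (fun z => g z - r * f z) z i = pd g z i - r * pd f z i := by
  have h := (hg z).hasFDerivAt.sub ((hf z).hasFDerivAt.const_mul r)
  have h' : fderiv ℝ (fun z => g z - r * f z) z = _ := h.fderiv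
  simp [pd, h']

lemma zc_add_smul_coordVec_self {n i : ℕ} (hi : i < n) (z : Fin n → ℝ) (s : ℝ) :
    zc (z + s • coordVec n i) i = zc z i + s := by
  simp [zc, coordVec, hi]

lemma zc_add_smul_coordVec_of_ne {n i j : ℕ} (hij : i ≠ j) (z : Fin n → ℝ) (s : ℝ) :
    zc (z + s • coordVec n j) i = zc z i := by
  by_cases hi : i < n <;> simp [zc, coordVec, hi, hij]

/-- The total derivative of a function of `z_0, …, z_m` is affine in `z_{m+1}`. -/
lemma sum_pd_mul_zc_add {n m : ℕ} {f : (Fin n → ℝ) → ℝ} (hf : IndepOfCoord f (m + 1))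
    (hm : m + 1 < n) (z : Fin n → ℝ) (s : ℝ) :
    ∑ i ∈ Finset.range (m + 1), pd f (z + s • coordVec n (m + 1)) i *
        zc (z + s • coordVec n (m + 1)) (i + 1) =
      (∑ i ∈ Finset.range (m + 1), pd f z i * zc z (i + 1)) + pd f z m * s := by
  have hpd : ∀ i, pd f (z + s • coordVec n (m + 1)) i = pd f z i := fun i => hf.pd i z s
  have hlow : ∑ i ∈ Finset.range m, pd f z i * zc (z + s • coordVec n (m + 1)) (i + 1) =
      ∑ i ∈ Finset.range m, pd f z i * zc z (i + 1) := by
    refine Finset.sum_congr rfl fun i hi => ?_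
    rw [zc_add_smul_coordVec_of_ne (by have := Finset.mem_range.1 hi; omega)]
  simp only [hpd]
  rw [Finset.sum_range_succ, Finset.sum_range_succ, hlow, zc_add_smul_coordVec_self hm]
  ring

lemma add_smul_coordVec_zero {n i : ℕ} (hi : i ≠ 0) (z : Fin (n + 1) → ℝ) (s : ℝ) :
    (z + s • coordVec (n + 1) i) 0 = z 0 := by
  simp [coordVec, hi.symm]

/-- Proposition 2 of the paper.  In branch II (`f31 = λ·f11`, `λ ≠ 0`,
`λ² ≠ 1`, `f11` and `f11'` nowhere zero), under the structure equations with
`∂F/∂z_k` nowhere zero, no smooth `a, b, c` on a nonempty open set satisfy the Codazzi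
identities and the Gauss equation. -/
theorem stmt4 (k : ℕ) (hk : 2 ≤ k) (η : ℝ) (hη : η ≠ 0)
    (f11 f31 : ℝ → ℝ) (f12 f22 f32 F : (Fin (k+1) → ℝ) → ℝ)
    (hf11 : ContDiff ℝ (⊤ : ℕ∞) f11) (hf31 : ContDiff ℝ (⊤ : ℕ∞) f31)
    (hf12 : ContDiff ℝ (⊤ : ℕ∞) f12) (hf22 : ContDiff ℝ (⊤ : ℕ∞) f22)
    (hf32 : ContDiff ℝ (⊤ : ℕ∞) f32) (hF : ContDiff ℝ (⊤ : ℕ∞) F)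
    (hdep12 : DependsOnFirst k f12) (hdep32 : DependsOnFirst k f32)
    (hdep22 : DependsOnFirst (k-1) f22)
    (lam : ℝ) (hlam0 : lam ≠ 0) (hlam1 : lam ^ 2 ≠ 1)
    (h31 : ∀ z0 : ℝ, f31 z0 = lam * f11 z0)
    (h11 : ∀ z0 : ℝ, f11 z0 ≠ 0) (h11d : ∀ z0 : ℝ, deriv f11 z0 ≠ 0)
    (hS : StructEqs k η f11 f31 f12 f22 f32 F)
    (hFk : ∀ z : Fin (k+1) → ℝ, pd F z k ≠ 0) :
    ¬ ∃ (U : Set (ℝ × ℝ)) (a b c : ℝ × ℝ → ℝ),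
      U.Nonempty ∧ IsOpen U ∧
      ContDiffOn ℝ (⊤ : ℕ∞) a U ∧ ContDiffOn ℝ (⊤ : ℕ∞) b U ∧
      ContDiffOn ℝ (⊤ : ℕ∞) c U ∧
      Codazzi k η f11 f31 f12 f22 f32 U a b c ∧
      (∀ p ∈ U, a p * c p - (b p) ^ 2 = -1) := by
  obtain ⟨l, rfl⟩ : ∃ l, k = l + 2 := ⟨k - 2, by omega⟩
  have htop : ((⊤ : ℕ∞) : WithTop ℕ∞) ≠ 0 := by simp
  have d12 := hf12.differentiable htop
  have d32 := hf32.differentiable htop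
  have d22 := hf22.differentiable htop
  have dF := hF.differentiable htop
  have hlam : lam ^ 2 - 1 ≠ 0 := sub_ne_zero.2 hlam1
  have h31d : ∀ x, deriv f31 x = lam * deriv f11 x := by
    intro x
    rw [funext h31]
    exact deriv_const_mul_field _
  have i12 : IndepOfCoord f12 (l + 2) := hdep12.indepOfCoord le_rfl
  have i32 : IndepOfCoord f32 (l + 2) := hdep32.indepOfCoord le_rfl
  have i22 : IndepOfCoord f22 (l + 2) := hdep22.indepOfCoord (by omega)
  have i22' : IndepOfCoord f22 (l + 1) := hdep22.indepOfCoord (by omega)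
  have p12 : ∀ z, pd f12 z (l + 1) ≠ 0 := by
    intro z h0
    refine hFk z (pd_eq_zero_of_constant_line dF fun s => ?_)
    have e1 := (hS z).1
    have e2 := (hS (z + s • coordVec _ (l + 2))).1
    rw [sum_pd_mul_zc_add i12 (by omega), i32, i22,
      add_smul_coordVec_zero (by omega), h0] at e2
    exact mul_left_cancel₀ (h11d (z 0)) (by linarith)
  set h : (Fin (l + 2 + 1) → ℝ) → ℝ := fun z => f32 z - lam * f12 z with hh
  have dh : Differentiable ℝ h := d32.sub (d12.const_mul lam)
  have pdh : ∀ z i, pd h z i = pd f32 z i - lam * pd f12 z i :=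
    fun z i => pd_sub_const_mul d12 d32 lam z i
  have ph : ∀ z, pd h z (l + 1) = 0 := by
    intro z
    have e1 := (hS z).1
    have e3 := (hS z).2.2
    have e1' := (hS (z + (1 : ℝ) • coordVec _ (l + 2))).1
    have e3' := (hS (z + (1 : ℝ) • coordVec _ (l + 2))).2.2
    rw [sum_pd_mul_zc_add i12 (by omega), i32, i22,
      add_smul_coordVec_zero (by omega)] at e1'
    rw [sum_pd_mul_zc_add i32 (by omega), i12, i22,
      add_smul_coordVec_zero (by omega)] at e3'
    rw [h31d] at e3 e3'
    rw [pdh]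
    linear_combination lam * (e1' - e1) - (e3' - e3)
  have ih : IndepOfCoord h (l + 1) := indepOfCoord_of_pd_eq_zero dh ph
  have S2 : ∀ z, ∑ i ∈ Finset.range (l + 1), pd f22 z i * zc z (i + 1) = f11 (z 0) * h z := by
    intro z
    refine (hS z).2.1.trans ?_
    rw [h31, hh]
    ring
  have p22 : ∀ z, pd f22 z l = 0 := by
    intro z
    have e := S2 z
    have e' := S2 (z + (1 : ℝ) • coordVec _ (l + 1))
    rw [sum_pd_mul_zc_add i22' (by omega), ih, add_smul_coordVec_zero (by omega)] at e'
    linarith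
  have i22l : IndepOfCoord f22 l := indepOfCoord_of_pd_eq_zero d22 p22
  have Dh : ∀ z, ∑ i ∈ Finset.range (l + 1), pd h z i * zc z (i + 1) =
      η * lam * h z + (lam ^ 2 - 1) * (η * f12 z - f11 (z 0) * f22 z) := by
    intro z
    obtain ⟨e1, -, e3⟩ := hS z
    have hsum : ∑ i ∈ Finset.range (l + 2), pd h z i * zc z (i + 1) =
        (∑ i ∈ Finset.range (l + 2), pd f32 z i * zc z (i + 1)) -
          lam * ∑ i ∈ Finset.range (l + 2), pd f12 z i * zc z (i + 1) := by
      rw [Finset.mul_sum, ← Finset.sum_sub_distrib]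
      refine Finset.sum_congr rfl fun i _ => ?_
      rw [pdh]
      ring
    rw [Finset.sum_range_succ, ph, zero_mul, add_zero] at hsum
    rw [h31d] at e3
    rw [h31] at e1
    rw [hsum, hh]
    linear_combination lam * e1 - e3
  have phl : ∀ z, pd h z l ≠ 0 := by
    intro z h0
    refine p12 z (pd_eq_zero_of_constant_line d12 fun s => ?_)
    have e := Dh z
    have e' := Dh (z + s • coordVec _ (l + 1))
    rw [sum_pd_mul_zc_add ih (by omega), ih, i22', add_smul_coordVec_zero (by omega), h0] at e'
    exact mul_left_cancel₀ (mul_ne_zero hlam hη) (by linarith)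
  have hl : l ≠ 0 := by
    rintro rfl
    have hz : ∀ z, h z = 0 := by
      intro z
      have e := S2 z
      rw [Finset.sum_range_one, p22, zero_mul] at e
      exact (mul_eq_zero.1 e.symm).resolve_left (h11 _)
    exact phl 0 (pd_eq_zero_of_constant_line dh fun s => by rw [hz, hz])
  rintro ⟨U, a, b, c, ⟨p, hp⟩, -, -, -, -, hC, hG⟩
  have C1 : ∀ z : Fin (l + 2 + 1) → ℝ,
      f11 (z 0) * fderiv ℝ a p (0, 1) + η * fderiv ℝ b p (0, 1)
        + f12 z * (η * lam * (a p - c p) - fderiv ℝ a p (1, 0)) - f22 z * fderiv ℝ b p (1, 0)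
        - 2 * b p * f11 (z 0) * h z
        + (a p - c p) * (η * h z - lam * f11 (z 0) * f22 z) = 0 := by
    intro z
    have e := (hC p hp z).1
    rw [h31] at e
    rw [hh]
    linear_combination e
  have hax : η * lam * (a p - c p) - fderiv ℝ a p (1, 0) = 0 := by
    obtain ⟨s, hs⟩ := exists_ne_of_pd_ne_zero d12 (p12 0)
    have e := C1 0
    have e' := C1 (0 + s • coordVec _ (l + 1))
    rw [i22', ih, add_smul_coordVec_zero (by omega)] at e'
    refine (mul_eq_zero.1 ?_).resolve_left (sub_ne_zero.2 hs)
    linear_combination e' - e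
  have key : ∀ x : ℝ, η * (a p - c p) - 2 * b p * f11 x = 0 := by
    intro x
    obtain ⟨s, hs⟩ := exists_ne_of_pd_ne_zero dh (phl fun _ => x)
    have e := C1 fun _ => x
    have e' := C1 ((fun _ => x) + s • coordVec _ l)
    rw [i22l, add_smul_coordVec_zero hl, hax] at e'
    rw [hax] at e
    refine (mul_eq_zero.1 ?_).resolve_left (sub_ne_zero.2 hs)
    linear_combination e' - e
  have hne : f11 0 ≠ f11 1 := by
    intro he
    obtain ⟨x, -, hx⟩ := exists_deriv_eq_zero zero_lt_one hf11.continuous.continuousOn he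
    exact h11d x hx
  have hb : b p = 0 := by
    refine (mul_eq_zero.1 ?_).resolve_right (sub_ne_zero.2 hne)
    linear_combination (key 1 - key 0) / 2
  have hac : a p - c p = 0 := by
    have e := key 0
    rw [hb] at e
    exact (mul_eq_zero.1 (by linarith : η * (a p - c p) = 0)).resolve_left hη
  have hg := hG p hp
  rw [hb, ← sub_eq_zero.1 hac] at hg
  nlinarith [mul_self_nonneg (a p)]
end

section
/- Suppose f31² − f11² is identically equal to a nonzero constant C, the function L := f11·f31′ − f31·f11′ is nowhere zero, and f11 and f31 are nowhere zero. Assume the structure equations (S1)–(S3) hold and ∂F/∂z_k is nowhere zero. Then for every (z0,…,z_k) ∈ ℝ^{k+1}: (i) f11(z0)·(∂f12/∂z_{k−1})(z0,…,z_{k−1}) − f31(z0)·(∂f32/∂z_{k−1})(z0,…,z_{k−1}) = 0; (ii) f11(z0)·(∂f32/∂z_{k−1})(z0,…,z_{k−1}) − f31(z0)·(∂f12/∂z_{k−1})(z0,…,z_{k−1}) = L(z0)·(∂F/∂z_k)(z0,…,z_k), which is nonzero. Consequently ∂f12/∂z_{k−1} and ∂f32/∂z_{k−1} are nowhere zero and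 f11/f31 = (∂f32/∂z_{k−1})/(∂f12/∂z_{k−1}) at every point. -/
open Real Finset

/-- The `i`-th coordinate direction, as used in `pd`. -/
def coordDir (n i : ℕ) : Fin n → ℝ := fun j => if (j : ℕ) = i then 1 else 0

lemma DependsOnFirst.mono {n m m' : ℕ} {f : (Fin n → ℝ) → ℝ} (hf : DependsOnFirst m f)
    (h : m ≤ m') : DependsOnFirst m' f :=
  fun z w hzw => hf z w fun j hj => hzw j (hj.trans_le h)

lemma DependsOnFirst.add_smul_coordDir {n m i : ℕ} {f : (Fin n → ℝ) → ℝ}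
    (hf : DependsOnFirst m f) (h : m ≤ i) (z : Fin n → ℝ) (t : ℝ) :
    f (z + t • coordDir n i) = f z := by
  refine hf _ _ fun j hj => ?_
  simp [coordDir, (hj.trans_le h).ne]

lemma DependsOnFirst.pd_add_smul_coordDir {n m i : ℕ} {f : (Fin n → ℝ) → ℝ}
    (hf : DependsOnFirst m f) (h : m ≤ i) (z : Fin n → ℝ) (t : ℝ) (j : ℕ) :
    pd f (z + t • coordDir n i) j = pd f z j := by
  unfold pd
  rw [← fderiv_comp_add_right]
  simp only [hf.add_smul_coordDir h]

lemma hasDerivAt_pd {n : ℕ} {f : (Fin n → ℝ) → ℝ} {z : Fin n → ℝ}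
    (hf : DifferentiableAt ℝ f z) (i : ℕ) :
    HasDerivAt (fun t : ℝ => f (z + t • coordDir n i)) (pd f z i) 0 :=
  hf.hasFDerivAt.hasLineDerivAt (coordDir n i)

/-- Comparing the coefficients of the top variable `z_k` in an evolution identity
`a(z_0) F = ∑ (∂f/∂z_i) z_{i+1} + R`, where `f` and `R` do not involve `z_k`. -/
lemma mul_pd_eq_of_evolution {k : ℕ} (hk : 1 ≤ k) {a : ℝ → ℝ} {f F R : (Fin (k+1) → ℝ) → ℝ}
    (hF : Differentiable ℝ F) (hf : DependsOnFirst k f) (hR : DependsOnFirst k R)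
    (h : ∀ z : Fin (k+1) → ℝ,
      a (z 0) * F z = (∑ i ∈ Finset.range k, pd f z i * zc z (i+1)) + R z)
    (z : Fin (k+1) → ℝ) : a (z 0) * pd F z k = pd f z (k-1) := by
  have hline : ∀ t : ℝ, a (z 0) * F (z + t • coordDir (k+1) k)
      = a (z 0) * F z + t * pd f z (k-1) := by
    intro t
    have h0 : (z + t • coordDir (k+1) k) 0 = z 0 := by
      simp [coordDir, show ¬ 0 = k by omega]
    have hw := h (z + t • coordDir (k+1) k)
    rw [h0, hR.add_smul_coordDir le_rfl] at hw
    rw [hw, h z]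
    obtain ⟨m, rfl⟩ : ∃ m, k = m + 1 := ⟨k - 1, by omega⟩
    simp only [hf.pd_add_smul_coordDir le_rfl, Finset.sum_range_succ, Nat.add_sub_cancel]
    have hlow : ∀ i ∈ Finset.range m,
        pd f z i * zc (z + t • coordDir (m+1+1) (m+1)) (i+1) = pd f z i * zc z (i+1) := by
      intro i hi
      have hi' := Finset.mem_range.mp hi
      simp [zc, coordDir, hi'.ne]
    have htop : zc (z + t • coordDir (m+1+1) (m+1)) (m+1) = zc z (m+1) + t := by
      simp [zc, coordDir]
    rw [Finset.sum_congr rfl hlow, htop]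
    ring
  have h1 := (hasDerivAt_pd (hF z) k).const_mul (a (z 0))
  have h2 : HasDerivAt (fun t : ℝ => a (z 0) * F z + t * pd f z (k-1)) (pd f z (k-1)) 0 := by
    simpa using ((hasDerivAt_id (0 : ℝ)).mul_const (pd f z (k-1))).const_add (a (z 0) * F z)
  simp only [hline] at h1
  exact h1.unique h2

/-- If `g² - f²` is constant then `g g' = f f'`. -/
lemma mul_deriv_eq_of_sq_sub_sq_eq_const {f g : ℝ → ℝ} (hf : Differentiable ℝ f)
    (hg : Differentiable ℝ g) {C : ℝ} (h : ∀ x, g x ^ 2 - f x ^ 2 = C) (x : ℝ) :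
    g x * deriv g x = f x * deriv f x := by
  have h1 := ((hg x).hasDerivAt.pow 2).sub ((hf x).hasDerivAt.pow 2)
  have h2 : HasDerivAt (g ^ 2 - f ^ 2) 0 x := by
    rw [show g ^ 2 - f ^ 2 = fun _ => C from funext h]
    exact hasDerivAt_const x C
  have h3 := h1.unique h2
  norm_num at h3
  linarith

/-- In branch IV (`f31² − f11² ≡ C ≠ 0`, `L` nowhere zero, `f11`,
`f31` nowhere zero), the structure equations with `∂F/∂z_k` nowhere zero force the
identities (i)–(ii); consequently `∂f12/∂z_{k-1}` and `∂f32/∂z_{k-1}` are nowhere zero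
and `f11/f31 = (∂f32/∂z_{k-1})/(∂f12/∂z_{k-1})` everywhere. -/
theorem stmt13 (k : ℕ) (hk : 2 ≤ k) (η : ℝ) (hη : η ≠ 0)
    (f11 f31 : ℝ → ℝ) (f12 f22 f32 F : (Fin (k+1) → ℝ) → ℝ)
    (hf11 : ContDiff ℝ (⊤ : ℕ∞) f11) (hf31 : ContDiff ℝ (⊤ : ℕ∞) f31)
    (hf12 : ContDiff ℝ (⊤ : ℕ∞) f12) (hf22 : ContDiff ℝ (⊤ : ℕ∞) f22)
    (hf32 : ContDiff ℝ (⊤ : ℕ∞) f32) (hF : ContDiff ℝ (⊤ : ℕ∞) F)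
    (hdep12 : DependsOnFirst k f12) (hdep32 : DependsOnFirst k f32)
    (hdep22 : DependsOnFirst (k-1) f22)
    (hS : StructEqs k η f11 f31 f12 f22 f32 F)
    (hFk : ∀ z : Fin (k+1) → ℝ, pd F z k ≠ 0)
    (C : ℝ) (hC : C ≠ 0) (hC31 : ∀ z0 : ℝ, (f31 z0) ^ 2 - (f11 z0) ^ 2 = C)
    (hL : ∀ z0 : ℝ, f11 z0 * deriv f31 z0 - f31 z0 * deriv f11 z0 ≠ 0)
    (h11 : ∀ z0 : ℝ, f11 z0 ≠ 0) (h31 : ∀ z0 : ℝ, f31 z0 ≠ 0) :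
    ∀ z : Fin (k+1) → ℝ,
      f11 (z 0) * pd f12 z (k-1) - f31 (z 0) * pd f32 z (k-1) = 0 ∧
      (f11 (z 0) * pd f32 z (k-1) - f31 (z 0) * pd f12 z (k-1) =
          (f11 (z 0) * deriv f31 (z 0) - f31 (z 0) * deriv f11 (z 0)) * pd F z k ∧
        f11 (z 0) * pd f32 z (k-1) - f31 (z 0) * pd f12 z (k-1) ≠ 0) ∧
      pd f12 z (k-1) ≠ 0 ∧ pd f32 z (k-1) ≠ 0 ∧
      f11 (z 0) / f31 (z 0) = pd f32 z (k-1) / pd f12 z (k-1) := by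
  intro z
  have hFd : Differentiable ℝ F := hF.differentiable (by simp)
  have hinv : ∀ {g : ℝ → ℝ} {f : (Fin (k+1) → ℝ) → ℝ}, DependsOnFirst k f →
      DependsOnFirst k (fun w => η * f w - g (w 0) * f22 w) := by
    intro g f hf w w' hww
    have h0 : w 0 = w' 0 := hww 0 (by simp; omega)
    simp only [hf w w' hww, h0, hdep22.mono (Nat.sub_le k 1) w w' hww]
  have e1 : deriv f11 (z 0) * pd F z k = pd f12 z (k-1) :=
    mul_pd_eq_of_evolution (by omega) hFd hdep12 (hinv (g := f31) hdep32)
      (fun w => by rw [(hS w).1]; ring) z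
  have e3 : deriv f31 (z 0) * pd F z k = pd f32 z (k-1) :=
    mul_pd_eq_of_evolution (by omega) hFd hdep32 (hinv (g := f11) hdep12)
      (fun w => by rw [(hS w).2.2]; ring) z
  have hd : f31 (z 0) * deriv f31 (z 0) = f11 (z 0) * deriv f11 (z 0) :=
    mul_deriv_eq_of_sq_sub_sq_eq_const (hf11.differentiable (by simp))
      (hf31.differentiable (by simp)) hC31 (z 0)
  have hLz := hL (z 0)
  have hd11 : deriv f11 (z 0) ≠ 0 := by
    intro h
    have h' : deriv f31 (z 0) = 0 := by simpa [h, h31] using hd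
    exact hLz (by simp [h, h'])
  have hd31 : deriv f31 (z 0) ≠ 0 := by
    intro h
    have h' : deriv f11 (z 0) = 0 := by simpa [h, h11] using hd.symm
    exact hLz (by simp [h, h'])
  have hii : f11 (z 0) * pd f32 z (k-1) - f31 (z 0) * pd f12 z (k-1) =
      (f11 (z 0) * deriv f31 (z 0) - f31 (z 0) * deriv f11 (z 0)) * pd F z k := by
    rw [← e1, ← e3]; ring
  have h12 : pd f12 z (k-1) ≠ 0 := e1 ▸ mul_ne_zero hd11 (hFk z)
  have h32 : pd f32 z (k-1) ≠ 0 := e3 ▸ mul_ne_zero hd31 (hFk z)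
  have hi : f11 (z 0) * pd f12 z (k-1) - f31 (z 0) * pd f32 z (k-1) = 0 := by
    rw [← e1, ← e3]; linear_combination -pd F z k * hd
  refine ⟨hi, ⟨hii, hii ▸ mul_ne_zero hLz (hFk z)⟩, h12, h32, ?_⟩
  rw [div_eq_div_iff (h31 (z 0)) h12]
  linear_combination hi
end
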